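/- (Löwdin orthogonalization) Let A = U Σ Vᵀ be an SVD of a real n×n matrix A. Then the orthogonal matrix U Vᵀ is a closest orthogonal matrix to A: for every n×n orthogonal matrix Q, ‖A − U Vᵀ‖ ≤ ‖A − Q‖ in the Frobenius norm. -/

import Mathlib

open Matrix

/-- The Frobenius norm of a matrix. -/
noncomputable def frobNorm {n : ℕ} (M : Matrix (Fin n) (Fin n) ℝ) : ℝ :=
  Real.sqrt (Matrix.trace (M * Mᵀ))

theorem trace_sub_mul_transpose_sub {n : ℕ} (A Q : Matrix (Fin n) (Fin n) ℝ) (hQ : Q * Qᵀ = 1) :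
    trace ((A - Q) * (A - Q)ᵀ) = trace (A * Aᵀ) - 2 * trace (A * Qᵀ) + n := by
  have h : trace (Q * Aᵀ) = trace (A * Qᵀ) := by
    rw [← trace_transpose, transpose_mul, transpose_transpose]
  simp only [transpose_sub, sub_mul, mul_sub, trace_sub, hQ, h, trace_one, Fintype.card_fin]
  ring

theorem diag_le_one_of_mul_transpose_eq_one {n : ℕ} {W : Matrix (Fin n) (Fin n) ℝ}
    (hW : W * Wᵀ = 1) (i : Fin n) : W i i ≤ 1 := by
  have h : ∑ j, W i j * W i j = 1 := by
    simpa [mul_apply] using congrFun (congrFun hW i) i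
  have hle : W i i * W i i ≤ ∑ j, W i j * W i j :=
    Finset.single_le_sum (fun j _ => mul_self_nonneg (W i j)) (Finset.mem_univ i)
  nlinarith

theorem trace_diagonal_mul_le_sum {n : ℕ} {W : Matrix (Fin n) (Fin n) ℝ} (hW : W * Wᵀ = 1)
    {σ : Fin n → ℝ} (hσ : ∀ i, 0 ≤ σ i) : trace (diagonal σ * W) ≤ ∑ i, σ i := by
  simp only [trace, diag_apply, diagonal_mul]
  exact Finset.sum_le_sum fun i _ =>
    mul_le_of_le_one_right (hσ i) (diag_le_one_of_mul_transpose_eq_one hW i)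

/-- Löwdin orthogonalization: if `A = U (diagonal σ) Vᵀ` is an SVD of a real `n×n`
matrix `A`, then `U Vᵀ` is a closest orthogonal matrix to `A` in Frobenius norm. -/
theorem loewdin_orthogonalization {n : ℕ}
    (A U V : Matrix (Fin n) (Fin n) ℝ) (σ : Fin n → ℝ)
    (hU : U * Uᵀ = 1) (hV : V * Vᵀ = 1)
    (hnonneg : ∀ i, 0 ≤ σ i) (hord : ∀ i j : Fin n, i ≤ j → σ j ≤ σ i)
    (hA : A = U * Matrix.diagonal σ * Vᵀ) :
    ∀ Q : Matrix (Fin n) (Fin n) ℝ, Q * Qᵀ = 1 →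
      frobNorm (A - U * Vᵀ) ≤ frobNorm (A - Q) := by
  intro Q hQ
  have hU' : Uᵀ * U = 1 := mul_eq_one_comm.mp hU
  have hV' : Vᵀ * V = 1 := mul_eq_one_comm.mp hV
  have hQ' : Qᵀ * Q = 1 := mul_eq_one_comm.mp hQ
  have hUV : (U * Vᵀ) * (U * Vᵀ)ᵀ = 1 := by
    rw [transpose_mul, transpose_transpose, Matrix.mul_assoc, ← Matrix.mul_assoc Vᵀ, hV',
      Matrix.one_mul, hU]
  have htrace (P : Matrix (Fin n) (Fin n) ℝ) :
      trace (A * Pᵀ) = trace (diagonal σ * (Vᵀ * Pᵀ * U)) := by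
    rw [hA, Matrix.mul_assoc, Matrix.mul_assoc, trace_mul_comm]
    simp only [Matrix.mul_assoc]
  have hW : (Vᵀ * Qᵀ * U) * (Vᵀ * Qᵀ * U)ᵀ = 1 := by
    calc (Vᵀ * Qᵀ * U) * (Vᵀ * Qᵀ * U)ᵀ = Vᵀ * (Qᵀ * (U * Uᵀ) * Q) * V := by
          simp only [transpose_mul, transpose_transpose, Matrix.mul_assoc]
      _ = 1 := by rw [hU, Matrix.mul_one, hQ', Matrix.mul_one, hV']
  have hmax : trace (A * (U * Vᵀ)ᵀ) = ∑ i, σ i := by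
    rw [htrace, transpose_mul, transpose_transpose, ← Matrix.mul_assoc Vᵀ, hV', Matrix.one_mul,
      hU', Matrix.mul_one, trace_diagonal]
  have hle : trace (A * Qᵀ) ≤ ∑ i, σ i := by
    rw [htrace]
    exact trace_diagonal_mul_le_sum hW hnonneg
  apply Real.sqrt_le_sqrt
  rw [trace_sub_mul_transpose_sub A _ hUV, trace_sub_mul_transpose_sub A Q hQ, hmax]
  linarith
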